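/- (Berberian–Orland) For the Berberian extension A_0 of a bounded operator A, the numerical range of A_0 equals the closure of the numerical range of A: W(A_0) = closure(W(A)). In particular, W(A_0) is closed. -/

import Mathlib

open Filter Topology
open scoped ComplexInnerProductSpace BoundedContinuousFunction

/-- A Banach limit on `ℓ^∞(ℕ)` (properties assumed on bounded sequences). -/
def IsBanachLimit (LIM : (ℕ → ℂ) → ℂ) : Prop :=
  (∀ x y : ℕ → ℂ, Bornology.IsBounded (Set.range x) → Bornology.IsBounded (Set.range y) →
      LIM (x + y) = LIM x + LIM y) ∧
  (∀ (c : ℂ) (x : ℕ → ℂ), Bornology.IsBounded (Set.range x) → LIM (c • x) = c * LIM x) ∧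
  (∀ x : ℕ → ℂ, Bornology.IsBounded (Set.range x) → (∀ n, 0 ≤ (x n).re ∧ (x n).im = 0) →
      0 ≤ (LIM x).re ∧ (LIM x).im = 0) ∧
  (∀ x : ℕ → ℂ, Bornology.IsBounded (Set.range x) → LIM (fun n => x (n + 1)) = LIM x) ∧
  (∀ (x : ℕ → ℂ) (z : ℂ), Tendsto x atTop (𝓝 z) → LIM x = z)

/-- The numerical range `W(T) = {⟨Tf, f⟩ : ‖f‖ = 1}`. -/
def numericalRange {K : Type*} [NormedAddCommGroup K] [InnerProductSpace ℂ K]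
    (T : K →L[ℂ] K) : Set ℂ :=
  {z | ∃ f : K, ‖f‖ = 1 ∧ ⟪f, T f⟫ = z}

namespace IsBanachLimit

variable {LIM : (ℕ → ℂ) → ℂ}

theorem apply_const (hLIM : IsBanachLimit LIM) (c : ℂ) : LIM (fun _ => c) = c :=
  hLIM.2.2.2.2 _ _ tendsto_const_nhds

theorem im_eq_zero (hLIM : IsBanachLimit LIM) {u : ℕ → ℂ} {C : ℝ} (hC : ∀ n, ‖u n‖ ≤ C)
    (hu : ∀ n, (u n).im = 0) : (LIM u).im = 0 := by
  have hb : Bornology.IsBounded (Set.range u) :=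
    isBounded_iff_forall_norm_le.2 ⟨C, by rintro _ ⟨n, rfl⟩; exact hC n⟩
  have hc : Bornology.IsBounded (Set.range fun _ : ℕ => (C : ℂ)) :=
    isBounded_iff_forall_norm_le.2 ⟨‖(C : ℂ)‖, by rintro _ ⟨n, rfl⟩; rfl⟩
  have hs : Bornology.IsBounded (Set.range (u + fun _ : ℕ => (C : ℂ))) :=
    isBounded_iff_forall_norm_le.2 ⟨C + ‖(C : ℂ)‖, by
      rintro _ ⟨n, rfl⟩
      exact (norm_add_le _ _).trans (add_le_add (hC n) le_rfl)⟩
  have h := (hLIM.2.2.1 _ hs fun n => ⟨by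
    have := (abs_le.1 ((Complex.abs_re_le_norm (u n)).trans (hC n))).1
    simp only [Pi.add_apply, Complex.add_re, Complex.ofReal_re]
    linarith, by simp [hu n]⟩).2
  rw [hLIM.1 _ _ hb hc, hLIM.apply_const] at h
  simpa using h

theorem re_nonneg (hLIM : IsBanachLimit LIM) {u : ℕ → ℂ} {C : ℝ} (hC : ∀ n, ‖u n‖ ≤ C)
    (hu : ∀ n, 0 ≤ (u n).re) : 0 ≤ (LIM u).re := by
  have hr : ∀ n, ‖((u n).re : ℂ)‖ ≤ C := fun n => by
    simpa using (Complex.abs_re_le_norm (u n)).trans (hC n)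
  have hi : ∀ n, ‖((u n).im : ℂ)‖ ≤ C := fun n => by
    simpa using (Complex.abs_im_le_norm (u n)).trans (hC n)
  have hrb : Bornology.IsBounded (Set.range fun n => ((u n).re : ℂ)) :=
    isBounded_iff_forall_norm_le.2 ⟨C, by rintro _ ⟨n, rfl⟩; exact hr n⟩
  have hib : Bornology.IsBounded (Set.range fun n => ((u n).im : ℂ)) :=
    isBounded_iff_forall_norm_le.2 ⟨C, by rintro _ ⟨n, rfl⟩; exact hi n⟩
  have hIb : Bornology.IsBounded (Set.range (Complex.I • fun n => ((u n).im : ℂ))) :=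
    isBounded_iff_forall_norm_le.2 ⟨C, by rintro _ ⟨n, rfl⟩; simpa using hi n⟩
  have hdecomp : u = (fun n => ((u n).re : ℂ)) + Complex.I • fun n => ((u n).im : ℂ) := by
    ext n
    simp [mul_comm Complex.I, Complex.re_add_im]
  rw [hdecomp, hLIM.1 _ _ hrb hIb, hLIM.2.1 _ _ hib]
  have h₁ := (hLIM.2.2.1 _ hrb fun n => ⟨by simpa using hu n, by simp⟩).1
  have h₂ := hLIM.im_eq_zero hi fun n => by simp
  simpa [h₂] using h₁

end IsBanachLimit

section NumericalRange

variable {K : Type*} [NormedAddCommGroup K] [InnerProductSpace ℂ K]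

theorem inner_div_norm_sq_mem_numericalRange (T : K →L[ℂ] K) {h : K} (hh : h ≠ 0) :
    ⟪h, T h⟫ / (‖h‖ : ℂ) ^ 2 ∈ numericalRange T := by
  have hn : (‖h‖ : ℂ) ≠ 0 := by simpa using hh
  refine ⟨((‖h‖ : ℂ)⁻¹) • h, by simp [norm_smul, hh], ?_⟩
  simp only [map_smul, inner_smul_left, inner_smul_right, map_inv₀, Complex.conj_ofReal]
  field_simp

/-- A phase making the cross terms of a sesquilinear form real. -/
theorem exists_norm_eq_one_im_add_eq_zero (a b : ℂ) :
    ∃ c : ℂ, ‖c‖ = 1 ∧ ((starRingEnd ℂ) c * a + c * b).im = 0 := by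
  obtain ⟨c, hc, h⟩ : ∃ c : ℂ, ‖c‖ = 1 ∧ (‖a - (starRingEnd ℂ) b‖ : ℂ) * c =
      a - (starRingEnd ℂ) b :=
    ⟨_, Complex.norm_exp_ofReal_mul_I _, Complex.norm_mul_exp_arg_mul_I _⟩
  refine ⟨c, hc, ?_⟩
  have hre := congrArg Complex.re h
  have him := congrArg Complex.im h
  simp only [Complex.re_ofReal_mul, Complex.im_ofReal_mul, Complex.sub_re, Complex.sub_im,
    Complex.conj_re, Complex.conj_im] at hre him
  simp only [Complex.add_im, Complex.mul_im, Complex.conj_re, Complex.conj_im]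
  linear_combination c.im * hre - c.re * him

theorem ofReal_mem_numericalRange (B : K →L[ℂ] K) (h₀ : (0 : ℂ) ∈ numericalRange B)
    (h₁ : (1 : ℂ) ∈ numericalRange B) {t : ℝ} (ht : t ∈ Set.Icc (0 : ℝ) 1) :
    (t : ℂ) ∈ numericalRange B := by
  obtain ⟨f₀, hf₀, hBf₀⟩ := h₀
  obtain ⟨g, hg, hBg⟩ := h₁
  obtain ⟨c, hc, hcim⟩ := exists_norm_eq_one_im_add_eq_zero ⟪f₀, B g⟫ ⟪g, B f₀⟫
  obtain ⟨f, hf, hBf, him⟩ : ∃ f : K, ‖f‖ = 1 ∧ ⟪f, B f⟫ = 0 ∧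
      (⟪f, B g⟫ + ⟪g, B f⟫).im = 0 :=
    ⟨c • f₀, by simp [norm_smul, hc, hf₀],
      by simp [hBf₀],
      by simpa only [map_smul, inner_smul_left, inner_smul_right] using hcim⟩
  let h : ℝ → K := fun s => ((1 - s : ℝ) : ℂ) • f + (s : ℂ) • g
  have hcont : Continuous h := by fun_prop
  have hform : ∀ s, ⟪h s, B (h s)⟫ =
      ((s ^ 2 + s * (1 - s) * (⟪f, B g⟫ + ⟪g, B f⟫).re : ℝ) : ℂ) := fun s => by
    have hr : (((⟪f, B g⟫ + ⟪g, B f⟫).re : ℝ) : ℂ) = ⟪f, B g⟫ + ⟪g, B f⟫ :=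
      Complex.ext (by simp) (by simpa using him.symm)
    simp only [h, map_add, map_smul, inner_add_left, inner_add_right, inner_smul_left,
      inner_smul_right, Complex.conj_ofReal, hBf, hBg, Complex.ofReal_add, Complex.ofReal_mul,
      Complex.ofReal_pow, hr, Complex.ofReal_sub, Complex.ofReal_one, map_sub, map_one]
    ring
  have hne : ∀ s, h s ≠ 0 := fun s hs => by
    have key : ((s : ℂ)) • g = (-((1 - s : ℝ) : ℂ)) • f := by
      rw [neg_smul, eq_neg_iff_add_eq_zero, add_comm]; exact hs
    have hquad : ((s : ℂ) * s) = 0 := by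
      have h₁ : ⟪(s : ℂ) • g, B ((s : ℂ) • g)⟫ = (s : ℂ) * s := by
        simp [hBg]
      rw [← h₁, key]
      simp [hBf]
    have hs0 : s = 0 := by simpa using hquad
    subst hs0
    have : f = 0 := by simpa [h] using hs
    simp [this] at hf
  have hq : Continuous fun s : ℝ => (⟪h s, B (h s)⟫).re / ‖h s‖ ^ 2 :=
    (Complex.continuous_re.comp (hcont.inner (B.continuous.comp hcont))).div
      (hcont.norm.pow 2) fun s => by simpa using hne s
  have hiv := intermediate_value_Icc (zero_le_one (α := ℝ)) hq.continuousOn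
  obtain ⟨s, -, hs⟩ := hiv (show t ∈ _ by simpa [h, hBf, hBg, hg] using ht)
  have hmem := inner_div_norm_sq_mem_numericalRange B (hne s)
  convert hmem using 1
  rw [← hs]
  simp only [hform, Complex.ofReal_re]
  push_cast
  rfl

/-- The Toeplitz–Hausdorff theorem. -/
theorem convex_numericalRange (T : K →L[ℂ] K) : Convex ℝ (numericalRange T) := by
  intro z hz w hw a b ha hb hab
  by_cases hzw : z = w
  · subst hzw
    rwa [← add_smul, hab, one_smul]
  have hd : w - z ≠ 0 := sub_ne_zero.2 (Ne.symm hzw)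
  let B : K →L[ℂ] K := (w - z)⁻¹ • (T - z • ContinuousLinearMap.id ℂ K)
  have hB : ∀ f : K, ‖f‖ = 1 → ⟪f, B f⟫ = (w - z)⁻¹ * (⟪f, T f⟫ - z) := fun f hf => by
    simp [B, inner_self_eq_norm_sq_to_K, hf]
  have h₀ : (0 : ℂ) ∈ numericalRange B := by
    obtain ⟨f, hf, hfz⟩ := hz
    exact ⟨f, hf, by simp [hB f hf, hfz]⟩
  have h₁ : (1 : ℂ) ∈ numericalRange B := by
    obtain ⟨f, hf, hfw⟩ := hw
    exact ⟨f, hf, by rw [hB f hf, hfw, inv_mul_cancel₀ hd]⟩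
  obtain ⟨f, hf, hfb⟩ := ofReal_mem_numericalRange B h₀ h₁ (t := b) ⟨hb, by linarith⟩
  refine ⟨f, hf, ?_⟩
  rw [hB f hf, inv_mul_eq_iff_eq_mul₀ hd] at hfb
  have ha' : (a : ℂ) = 1 - b := by rw [eq_sub_of_add_eq hab]; simp
  simp only [Complex.real_smul, ha']
  linear_combination hfb

theorem re_inner_le_of_forall_numericalRange (T : K →L[ℂ] K) {c : ℂ} {s : ℝ}
    (hs : ∀ w ∈ numericalRange T, (c * w).re ≤ s) (f : K) :
    (c * ⟪f, T f⟫).re ≤ s * ‖f‖ ^ 2 := by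
  by_cases hf : f = 0
  · simp [hf]
  have hn : 0 < ‖f‖ ^ 2 := by positivity
  have h := hs _ (inner_div_norm_sq_mem_numericalRange T hf)
  rwa [← mul_div_assoc, ← Complex.ofReal_pow, Complex.div_ofReal_re, div_le_iff₀ hn] at h

end NumericalRange

section BerberianExtension

variable {H : Type*} [NormedAddCommGroup H] [InnerProductSpace ℂ H]
  {LIM : (ℕ → ℂ) → ℂ} {H₀ : Type*} [NormedAddCommGroup H₀] [InnerProductSpace ℂ H₀]
  {e : (ℕ →ᵇ H) →ₗ[ℂ] H₀} {A : H →L[ℂ] H} {A₀ : H₀ →L[ℂ] H₀}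

theorem closure_numericalRange_subset_berberian (hLIM : IsBanachLimit LIM)
    (hinner : ∀ x y : ℕ →ᵇ H, ⟪e x, e y⟫ = LIM fun n => ⟪x n, y n⟫)
    (hA₀ : ∀ x y : ℕ →ᵇ H, (∀ n, y n = A (x n)) → A₀ (e x) = e y) :
    closure (numericalRange A) ⊆ numericalRange A₀ := by
  intro z hz
  obtain ⟨w, hw, hwz⟩ := mem_closure_iff_seq_limit.1 hz
  choose f hf hfw using hw
  let x : ℕ →ᵇ H := BoundedContinuousFunction.ofNormedAddCommGroupDiscrete f 1 fun n => (hf n).le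
  let y : ℕ →ᵇ H := A.compLeftContinuousBounded ℕ x
  have hsq : ⟪e x, e x⟫ = 1 := by
    rw [hinner]
    refine Eq.trans (congrArg LIM (funext fun n => ?_)) (hLIM.apply_const 1)
    simp [x, inner_self_eq_norm_sq_to_K, hf n]
  refine ⟨e x, ?_, ?_⟩
  · have h := inner_self_eq_norm_sq (𝕜 := ℂ) (e x)
    rw [hsq] at h
    have : ‖e x‖ ^ 2 = 1 := by simpa using h.symm
    exact (pow_eq_one_iff_of_nonneg (norm_nonneg _) two_ne_zero).1 this
  · rw [hA₀ x y fun n => rfl, hinner]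
    refine hLIM.2.2.2.2 _ _ ?_
    convert hwz using 1
    exact funext hfw

theorem re_inner_berberian_le (hLIM : IsBanachLimit LIM) (hdense : DenseRange e)
    (hinner : ∀ x y : ℕ →ᵇ H, ⟪e x, e y⟫ = LIM fun n => ⟪x n, y n⟫)
    (hA₀ : ∀ x y : ℕ →ᵇ H, (∀ n, y n = A (x n)) → A₀ (e x) = e y) {c : ℂ} {s : ℝ}
    (hs : ∀ w ∈ numericalRange A, (c * w).re ≤ s) (f : H₀) :
    (c * ⟪f, A₀ f⟫).re ≤ s * ‖f‖ ^ 2 := by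
  refine hdense.induction_on f (isClosed_le (by fun_prop) (by fun_prop)) fun x => ?_
  let y : ℕ →ᵇ H := A.compLeftContinuousBounded ℕ x
  let v : ℕ →ᵇ H := (s : ℂ) • x - c • y
  have hv : ∀ n, ‖⟪x n, v n⟫‖ ≤ ‖x‖ * ‖v‖ := fun n =>
    (norm_inner_le_norm _ _).trans
      (mul_le_mul (x.norm_coe_le_norm n) (v.norm_coe_le_norm n) (norm_nonneg _) (norm_nonneg _))
  have hpos : 0 ≤ (⟪e x, e v⟫).re := by
    rw [hinner]
    refine hLIM.re_nonneg hv fun n => ?_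
    have h := re_inner_le_of_forall_numericalRange A hs (x n)
    have hvn : v n = (s : ℂ) • x n - c • A (x n) := rfl
    rw [hvn, inner_sub_right, inner_smul_right, inner_smul_right, inner_self_eq_norm_sq_to_K,
      Complex.sub_re, Complex.re_ofReal_mul, sub_nonneg]
    refine h.trans_eq ?_
    norm_cast
  have hev : e v = (s : ℂ) • e x - c • A₀ (e x) := by
    rw [hA₀ x y fun n => rfl, map_sub, map_smul, map_smul]
  rw [hev, inner_sub_right, inner_smul_right, inner_smul_right, inner_self_eq_norm_sq_to_K,
    Complex.sub_re, Complex.re_ofReal_mul, sub_nonneg] at hpos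
  refine hpos.trans_eq ?_
  norm_cast

theorem numericalRange_berberian_subset_closure (hLIM : IsBanachLimit LIM) (hdense : DenseRange e)
    (hinner : ∀ x y : ℕ →ᵇ H, ⟪e x, e y⟫ = LIM fun n => ⟪x n, y n⟫)
    (hA₀ : ∀ x y : ℕ →ᵇ H, (∀ n, y n = A (x n)) → A₀ (e x) = e y) :
    numericalRange A₀ ⊆ closure (numericalRange A) := by
  rintro z ⟨f, hf, rfl⟩
  by_contra hz
  obtain ⟨φ, s, hφ, hsz⟩ := RCLike.geometric_hahn_banach_closed_point (𝕜 := ℂ)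
    (convex_numericalRange A).closure isClosed_closure hz
  have hmul : ∀ w, φ w = φ 1 * w := fun w => by
    rw [mul_comm, ← smul_eq_mul, ← map_smul, smul_eq_mul, mul_one]
  have h := re_inner_berberian_le hLIM hdense hinner hA₀ (c := φ 1) (s := s)
    (fun w hw => by rw [← hmul]; exact (hφ w (subset_closure hw)).le) f
  rw [← hmul, hf, one_pow, mul_one] at h
  exact absurd hsz (not_lt.2 h)

end BerberianExtension

/-- Berberian–Orland: for the Berberian extension `A₀` of `A`
(on the Hilbert space `H₀` obtained from bounded sequences in `H` modulo the
Banach-limit null space, via the canonical map `e` with dense range),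
`W(A₀) = closure (W(A))`; in particular `W(A₀)` is closed. -/
theorem berberian_numericalRange_eq_closure {H : Type*}
    [NormedAddCommGroup H] [InnerProductSpace ℂ H] [CompleteSpace H]
    (LIM : (ℕ → ℂ) → ℂ) (hLIM : IsBanachLimit LIM)
    (H₀ : Type*) [NormedAddCommGroup H₀] [InnerProductSpace ℂ H₀] [CompleteSpace H₀]
    (e : (ℕ →ᵇ H) →ₗ[ℂ] H₀) (hdense : DenseRange e)
    (hinner : ∀ x y : ℕ →ᵇ H, ⟪e x, e y⟫ = LIM fun n => ⟪x n, y n⟫)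
    (A : H →L[ℂ] H) (A₀ : H₀ →L[ℂ] H₀)
    (hA₀ : ∀ x y : ℕ →ᵇ H, (∀ n, y n = A (x n)) → A₀ (e x) = e y) :
    numericalRange A₀ = closure (numericalRange A) ∧ IsClosed (numericalRange A₀) := by
  have h : numericalRange A₀ = closure (numericalRange A) :=
    (numericalRange_berberian_subset_closure hLIM hdense hinner hA₀).antisymm
      (closure_numericalRange_subset_berberian hLIM hinner hA₀)
  exact ⟨h, h ▸ isClosed_closure⟩
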